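/- arXiv:1602.03865 — 9 statements merged into one kernel-verified Lean document; each statement's English description precedes it below -/
import Mathlib

section
/- Let x_1, …, x_m be pairwise distinct points of ℝ^d that are pairwise in spacelike position with respect to Q (i.e. Q(x_j − x_k) > 0 for all j ≠ k), let φ : ℝ^d → ℝ be a linear functional and let D ∈ ℝ be such that Q(x_k) = φ(x_k) + D for every k. Then for all nonnegative reals t_1, …, t_m with t_1 + ⋯ + t_m = 1, the point y = t_1 x_1 + ⋯ + t_m x_m satisfies Q(y) ≤ φ(y) + D, and equality holds if and only if y = x_k for some k. (This is the key claim in the proof of Theorem 1.1: a simplex with vertices on a Q-sphere and in spacelike position is inscribed in the corresponding Q-ball, touching the Q-sphere exactly at its vertices.) -/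
/-- The gap in the convexity inequality for the quadratic form of `B`, as a weighted sum over
pairs of points. -/
theorem LinearMap.two_mul_sum_sub_apply_sum_smul {ι E : Type*} [Fintype ι] [AddCommGroup E]
    [Module ℝ E] (B : E →ₗ[ℝ] E →ₗ[ℝ] ℝ) (x : ι → E) (t : ι → ℝ) (hsum : ∑ k, t k = 1) :
    2 * (∑ k, t k * B (x k) (x k) - B (∑ k, t k • x k) (∑ k, t k • x k)) =
      ∑ i, ∑ j, t i * t j * B (x i - x j) (x i - x j) := by
  have hexpand : B (∑ k, t k • x k) (∑ k, t k • x k) =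
      ∑ i, ∑ j, t i * t j * B (x i) (x j) := by
    simp [map_sum, LinearMap.sum_apply, Finset.mul_sum, mul_assoc]
    rw [Finset.sum_comm]
    simp only [mul_left_comm]
  have hleft : ∑ i, ∑ j, t i * t j * B (x i) (x i) = ∑ k, t k * B (x k) (x k) := by
    refine Finset.sum_congr rfl fun i _ => ?_
    rw [← Finset.sum_mul, ← Finset.mul_sum, hsum, mul_one]
  have hright : ∑ i, ∑ j, t i * t j * B (x j) (x j) = ∑ k, t k * B (x k) (x k) := by
    rw [Finset.sum_comm, ← hleft]
    simp only [mul_comm]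
  have hswap : ∑ i, ∑ j, t i * t j * B (x j) (x i) = ∑ i, ∑ j, t i * t j * B (x i) (x j) := by
    rw [Finset.sum_comm]
    simp only [mul_comm]
  have hpair (i j : ι) : t i * t j * B (x i - x j) (x i - x j) =
      t i * t j * B (x i) (x i) + t i * t j * B (x j) (x j) -
        t i * t j * B (x i) (x j) - t i * t j * B (x j) (x i) := by
    simp only [map_sub, LinearMap.sub_apply]
    ring
  simp only [hpair, Finset.sum_sub_distrib, Finset.sum_add_distrib, hleft, hright, hswap, hexpand]
  ring


/-- Points on a Q-sphere in spacelike position: any convex combination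
lies in the Q-ball, with equality iff it is one of the points. -/
theorem stmt0 (d m : ℕ) (hm : 1 ≤ m)
    (B : (Fin d → ℝ) →ₗ[ℝ] (Fin d → ℝ) →ₗ[ℝ] ℝ)
    (hBsymm : ∀ x y, B x y = B y x)
    (x : Fin m → (Fin d → ℝ))
    (hdist : ∀ j k, j ≠ k → x j ≠ x k)
    (hspace : ∀ j k, j ≠ k → 0 < B (x j - x k) (x j - x k))
    (φ : (Fin d → ℝ) →ₗ[ℝ] ℝ) (D : ℝ)
    (hsphere : ∀ k, B (x k) (x k) = φ (x k) + D)
    (t : Fin m → ℝ) (ht : ∀ k, 0 ≤ t k) (hsum : ∑ k, t k = 1) :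
    B (∑ k, t k • x k) (∑ k, t k • x k) ≤ φ (∑ k, t k • x k) + D ∧
      (B (∑ k, t k • x k) (∑ k, t k • x k) = φ (∑ k, t k • x k) + D ↔
        ∃ j, (∑ k, t k • x k) = x j) := by
  have hgap := B.two_mul_sum_sub_apply_sum_smul x t hsum
  have haffine : φ (∑ k, t k • x k) + D = ∑ k, t k * B (x k) (x k) := by
    simp [hsphere, mul_add, Finset.sum_add_distrib, ← Finset.sum_mul, hsum]
  have hnonneg (i j : Fin m) : 0 ≤ t i * t j * B (x i - x j) (x i - x j) := by
    rcases eq_or_ne i j with rfl | hij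
    · simp
    · exact mul_nonneg (mul_nonneg (ht i) (ht j)) (hspace i j hij).le
  have hrow (i : Fin m) : 0 ≤ ∑ j, t i * t j * B (x i - x j) (x i - x j) :=
    Finset.sum_nonneg fun j _ => hnonneg i j
  refine ⟨?_, fun heq => ?_, ?_⟩
  · linarith [Finset.sum_nonneg fun i (_ : i ∈ Finset.univ) => hrow i]
  · have hzero : ∑ i, ∑ j, t i * t j * B (x i - x j) (x i - x j) = 0 := by linarith
    have hterm (i j : Fin m) : t i * t j * B (x i - x j) (x i - x j) = 0 := by
      have hi := (Finset.sum_eq_zero_iff_of_nonneg fun i _ => hrow i).1 hzero i (Finset.mem_univ i)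
      exact (Finset.sum_eq_zero_iff_of_nonneg fun j _ => hnonneg i j).1 hi j (Finset.mem_univ j)
    obtain ⟨i, -, hi⟩ : ∃ i ∈ Finset.univ, t i ≠ 0 :=
      Finset.exists_ne_zero_of_sum_ne_zero (by rw [hsum]; exact one_ne_zero)
    have hother (j : Fin m) (hj : j ≠ i) : t j = 0 :=
      (mul_eq_zero.1 ((mul_eq_zero.1 (hterm i j)).resolve_right
        (hspace i j hj.symm).ne')).resolve_left hi
    have hone : t i = 1 := by
      rwa [Fintype.sum_eq_single i hother] at hsum
    refine ⟨i, ?_⟩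
    rw [Fintype.sum_eq_single i fun j hj => by rw [hother j hj, zero_smul], hone, one_smul]
  · rintro ⟨j, hj⟩
    rw [hj, hsphere]
end

section
/- Let X ⊂ ℝ^d be a finite nonempty set such that any two distinct points of X are in spacelike position with respect to Q. For x ∈ X define the Voronoi region Vor_Q(x) = {y ∈ ℝ^d : Q(x − y) ≤ Q(x' − y) for all x' ∈ X}. Then: (1) for every x ∈ X, Vor_Q(x) is a closed convex set containing x in its topological interior; and (2) the union of the regions Vor_Q(x) over all x ∈ X is all of ℝ^d. -/
/-- The `B`-bisector inequality is affine in `y`. -/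
theorem bilin_sub_self_le_iff {E : Type*} [AddCommGroup E] [Module ℝ E]
    (B : E →ₗ[ℝ] E →ₗ[ℝ] ℝ) (hB : ∀ x y, B x y = B y x) (x x' y : E) :
    B (x - y) (x - y) ≤ B (x' - y) (x' - y) ↔ B (x' - x) y ≤ (B x' x' - B x x) / 2 := by
  simp only [map_sub, LinearMap.sub_apply, hB y x, hB y x']
  constructor <;> intro h <;> linarith

/-- Q-Voronoi regions of a finite spacelike set are closed, convex,
contain their sites in their interiors, and cover ℝ^d. -/
theorem stmt4 (d : ℕ)
    (B : (Fin d → ℝ) →ₗ[ℝ] (Fin d → ℝ) →ₗ[ℝ] ℝ)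
    (hBsymm : ∀ x y, B x y = B y x)
    (X : Finset (Fin d → ℝ)) (hX : X.Nonempty)
    (hsp : ∀ x ∈ X, ∀ y ∈ X, x ≠ y → 0 < B (x - y) (x - y)) :
    (∀ x ∈ X,
      IsClosed {y : Fin d → ℝ | ∀ x' ∈ X, B (x - y) (x - y) ≤ B (x' - y) (x' - y)} ∧
      Convex ℝ {y : Fin d → ℝ | ∀ x' ∈ X, B (x - y) (x - y) ≤ B (x' - y) (x' - y)} ∧
      x ∈ interior {y : Fin d → ℝ | ∀ x' ∈ X, B (x - y) (x - y) ≤ B (x' - y) (x' - y)}) ∧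
    (⋃ x ∈ X, {y : Fin d → ℝ | ∀ x' ∈ X, B (x - y) (x - y) ≤ B (x' - y) (x' - y)})
      = Set.univ := by
  have hset : ∀ x, {y : Fin d → ℝ | ∀ x' ∈ X, B (x - y) (x - y) ≤ B (x' - y) (x' - y)} =
      ⋂ x' ∈ X, {y | B (x' - x) y ≤ (B x' x' - B x x) / 2} := by
    intro x
    ext y
    simp only [Set.mem_ofPred_eq, Set.mem_iInter, bilin_sub_self_le_iff B hBsymm]
  have hcont : ∀ v, Continuous (B v) := fun v => (B v).continuous_of_finiteDimensional
  refine ⟨fun x hx => ⟨?_, ?_, ?_⟩, ?_⟩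
  · rw [hset]
    exact isClosed_biInter fun x' _ => isClosed_le (hcont _) continuous_const
  · rw [hset]
    exact convex_iInter₂ fun x' _ => convex_halfSpace_le (B (x' - x)).isLinear _
  · rw [hset, mem_interior_iff_mem_nhds, Filter.biInter_finset_mem]
    intro x' hx'
    rcases eq_or_ne x' x with rfl | hne
    · simp
    · have hlt : B (x' - x) x < (B x' x' - B x x) / 2 := by
        have h := hsp x' hx' x hx hne
        simp only [map_sub, LinearMap.sub_apply, hBsymm x x'] at h ⊢
        linarith
      exact ((hcont _).continuousAt.eventually_lt continuousAt_const hlt).mono fun _ => le_of_lt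
  · refine Set.eq_univ_of_forall fun y => ?_
    obtain ⟨x, hx, hmin⟩ := X.exists_min_image (fun x => B (x - y) (x - y)) hX
    exact Set.mem_biUnion hx hmin
end

section
/- Let g : ℝ^m × ℝ^k → ℝ^m × ℝ^k be the affine map g(y, z) = (A y + v, B y + C z + w), where A : ℝ^m → ℝ^m is a linear isomorphism with Q_V(A y) = Q_V(y) for all y, C : ℝ^k → ℝ^k is a linear isomorphism with Q_U(C z) = Q_U(z) for all z, B : ℝ^m → ℝ^k is any linear map, v ∈ ℝ^m and w ∈ ℝ^k. Then the set of 𝒬-balls is invariant under g: for every linear functional φ : ℝ^m × ℝ^k → ℝ and constant D ∈ ℝ there exist a linear functional φ' and a constant D' such that the image g({p : 𝒬(p) ≤ φ(p) + D}) equals {p : 𝒬(p) ≤ φ'(p) + D'}. -/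
/-- The equivalence `(y, z) ↦ (a y, b y + c z)` of a product given by a block triangular matrix
with invertible diagonal blocks. -/
def LinearEquiv.blockTriangular {R M N : Type*} [Ring R] [AddCommGroup M] [Module R M]
    [AddCommGroup N] [Module R N] (a : M ≃ₗ[R] M) (b : M →ₗ[R] N) (c : N ≃ₗ[R] N) :
    (M × N) ≃ₗ[R] (M × N) where
  toFun p := (a p.1, b p.1 + c p.2)
  invFun q := (a.symm q.1, c.symm (q.2 - b (a.symm q.1)))
  map_add' p q := by ext <;> simp [add_add_add_comm]
  map_smul' r p := by ext <;> simp
  left_inv p := by simp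
  right_inv q := by simp

/-- An affine map whose linear part preserves a symmetric bilinear form maps sublevel sets of
`B p p - φ p` to sets of the same kind. -/
theorem image_setOf_le_of_isometry {M : Type*} [AddCommGroup M] [Module ℝ M]
    (B : M →ₗ[ℝ] M →ₗ[ℝ] ℝ) (hB : ∀ p q, B p q = B q p)
    (T : M ≃ₗ[ℝ] M) (hT : ∀ p, B (T p) (T p) = B p p) (c : M) (φ : M →ₗ[ℝ] ℝ) (D : ℝ) :
    (fun p => T p + c) '' {p | B p p ≤ φ p + D} =
      {p | B p p ≤ (φ ∘ₗ T.symm.toLinearMap + (2 : ℝ) • B c) p +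
        (D - φ (T.symm c) - B c c)} := by
  have key (p : M) : B p p ≤ φ p + D ↔
      B (T p + c) (T p + c) ≤ (φ ∘ₗ T.symm.toLinearMap + (2 : ℝ) • B c) (T p + c) +
        (D - φ (T.symm c) - B c c) := by
    simp only [map_add, LinearMap.add_apply, LinearMap.smul_apply, LinearMap.comp_apply,
      LinearEquiv.coe_coe, LinearEquiv.symm_apply_apply, smul_eq_mul, hT, hB (T p) c]
    constructor <;> intro h <;> linarith
  ext q
  constructor
  · rintro ⟨p, hp, rfl⟩
    exact (key p).1 hp
  · intro hq
    have hTq : T (T.symm (q - c)) + c = q := by simp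
    refine ⟨T.symm (q - c), (key _).2 ?_, hTq⟩
    rwa [hTq]


/-- The set of 𝒬-balls is invariant under the symmetry group G of the
degenerate geometry. -/
theorem stmt6 (m k : ℕ) (hm : 1 ≤ m) (hk : 1 ≤ k)
    (BV : (Fin m → ℝ) →ₗ[ℝ] (Fin m → ℝ) →ₗ[ℝ] ℝ)
    (hBVsymm : ∀ y y', BV y y' = BV y' y)
    (BU : (Fin k → ℝ) →ₗ[ℝ] (Fin k → ℝ) →ₗ[ℝ] ℝ)
    (hBUsymm : ∀ z z', BU z z' = BU z' z)
    (A : (Fin m → ℝ) →ₗ[ℝ] (Fin m → ℝ)) (hA : ∀ y, BV (A y) (A y) = BV y y)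
    (hAbij : Function.Bijective A)
    (C : (Fin k → ℝ) →ₗ[ℝ] (Fin k → ℝ)) (hC : ∀ z, BU (C z) (C z) = BU z z)
    (hCbij : Function.Bijective C)
    (Bm : (Fin m → ℝ) →ₗ[ℝ] (Fin k → ℝ)) (v : Fin m → ℝ) (w : Fin k → ℝ)
    (φ : ((Fin m → ℝ) × (Fin k → ℝ)) →ₗ[ℝ] ℝ) (D : ℝ) :
    ∃ (φ' : ((Fin m → ℝ) × (Fin k → ℝ)) →ₗ[ℝ] ℝ) (D' : ℝ),
      (fun p : (Fin m → ℝ) × (Fin k → ℝ) => (A p.1 + v, Bm p.1 + C p.2 + w)) ''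
          {p : (Fin m → ℝ) × (Fin k → ℝ) | BV p.1 p.1 ≤ φ p + D}
        = {p : (Fin m → ℝ) × (Fin k → ℝ) | BV p.1 p.1 ≤ φ' p + D'} := by
  let T := LinearEquiv.blockTriangular (.ofBijective A hAbij) Bm (.ofBijective C hCbij)
  let F := LinearMap.fst ℝ (Fin m → ℝ) (Fin k → ℝ)
  exact ⟨_, _, image_setOf_le_of_isometry (BV.compl₁₂ F F) (fun p q => hBVsymm p.1 q.1) T
    (fun p => hA p.1) (v, w) φ D⟩
end

section
/- Let v₂, w₂ ∈ ℝ, and let a, b, c, d : ℝ → ℝ be functions such that a(t) → 1 and c(t) → 1 as t → 0⁺, b(0) = d(0) = 0, and b, d are differentiable at 0 with b'(0) = v₂ and d'(0) = w₂. For t > 0 let θ(t) denote the Euclidean angle between the vectors (a(t), b(t)) and (c(t), d(t)) in ℝ². Then θ(t)/t → |v₂ − w₂| as t → 0⁺. (This computes the angle in the degenerate plane ℝ^{1,0,1} between directions (1, v₂) and (1, w₂) in the same component as the derivative of the Euclidean angle along rescaled paths.) -/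
/-- The Euclidean angle between two vectors of ℝ². -/
noncomputable def euclAngle (u w : ℝ × ℝ) : ℝ :=
  Real.arccos ((u.1 * w.1 + u.2 * w.2) /
    (Real.sqrt (u.1 ^ 2 + u.2 ^ 2) * Real.sqrt (w.1 ^ 2 + w.2 ^ 2)))

open Filter Topology

theorem euclAngle_eq_arctan {u w : ℝ × ℝ} (h : 0 < u.1 * w.1 + u.2 * w.2) :
    euclAngle u w = Real.arctan (|u.1 * w.2 - u.2 * w.1| / (u.1 * w.1 + u.2 * w.2)) := by
  unfold euclAngle
  rw [← Real.sqrt_mul (by positivity)]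
  set P := u.1 * w.1 + u.2 * w.2 with hP
  set C := u.1 * w.2 - u.2 * w.1 with hC
  have hN : (u.1 ^ 2 + u.2 ^ 2) * (w.1 ^ 2 + w.2 ^ 2) = P ^ 2 + C ^ 2 := by
    rw [hP, hC]; ring
  rw [hN]
  have hpos : 0 < P ^ 2 + C ^ 2 := by positivity
  have hs : 0 < √(P ^ 2 + C ^ 2) := Real.sqrt_pos.mpr hpos
  rw [Real.arccos_eq_arctan (by positivity)]
  have hsin : 1 - (P / √(P ^ 2 + C ^ 2)) ^ 2 = (|C| / √(P ^ 2 + C ^ 2)) ^ 2 := by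
    rw [div_pow, div_pow, Real.sq_sqrt hpos.le, sq_abs]
    field_simp
    ring
  rw [hsin, Real.sqrt_sq (by positivity)]
  field_simp

theorem tendsto_arctan_div {α : Type*} {l : Filter α} {f g : α → ℝ} {L : ℝ}
    (hf : Tendsto f l (𝓝 0)) (hfg : Tendsto (fun x => f x / g x) l (𝓝 L)) :
    Tendsto (fun x => Real.arctan (f x) / g x) l (𝓝 L) := by
  have hslope : Tendsto (dslope Real.arctan 0) (𝓝 0) (𝓝 1) := by
    have h := (continuousAt_dslope_same.mpr (Real.differentiableAt_arctan 0)).tendsto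
    simpa [dslope_same] using h
  have h := (hslope.comp hf).mul hfg
  rw [one_mul] at h
  refine h.congr fun x => ?_
  have hx : f x * dslope Real.arctan 0 (f x) = Real.arctan (f x) := by
    simpa using sub_smul_dslope Real.arctan 0 (f x)
  rw [Function.comp_apply, ← hx]
  ring

theorem HasDerivAt.tendsto_div_nhdsGT_zero {f : ℝ → ℝ} {v : ℝ}
    (hf : HasDerivAt f v 0) (hf0 : f 0 = 0) :
    Tendsto (fun t => f t / t) (𝓝[>] 0) (𝓝 v) := by
  simpa [hf0, div_eq_inv_mul] using hf.tendsto_slope_zero_right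

/-- The degenerate-plane angle between (1, v₂) and (1, w₂) is the
derivative at 0 of the Euclidean angle along rescaled paths: θ(t)/t → |v₂ − w₂|. -/
theorem stmt10 (v₂ w₂ : ℝ) (a b c d : ℝ → ℝ)
    (ha : Filter.Tendsto a (nhdsWithin 0 (Set.Ioi 0)) (nhds 1))
    (hc : Filter.Tendsto c (nhdsWithin 0 (Set.Ioi 0)) (nhds 1))
    (hb0 : b 0 = 0) (hd0 : d 0 = 0)
    (hb : HasDerivAt b v₂ 0) (hd : HasDerivAt d w₂ 0) :
    Filter.Tendsto (fun t => euclAngle (a t, b t) (c t, d t) / t)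
      (nhdsWithin 0 (Set.Ioi 0)) (nhds |v₂ - w₂|) := by
  have hb' : Tendsto b (𝓝[>] 0) (𝓝 0) := by
    simpa [hb0] using hb.continuousAt.tendsto.mono_left nhdsWithin_le_nhds
  have hd' : Tendsto d (𝓝[>] 0) (𝓝 0) := by
    simpa [hd0] using hd.continuousAt.tendsto.mono_left nhdsWithin_le_nhds
  have hdot : Tendsto (fun t => a t * c t + b t * d t) (𝓝[>] 0) (𝓝 1) := by
    simpa using (ha.mul hc).add (hb'.mul hd')
  have hcross : Tendsto (fun t => |a t * d t - b t * c t|) (𝓝[>] 0) (𝓝 0) := by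
    simpa using ((ha.mul hd').sub (hb'.mul hc)).abs
  have hquot : Tendsto (fun t => |a t * d t - b t * c t| / (a t * c t + b t * d t))
      (𝓝[>] 0) (𝓝 0) := by
    simpa [Pi.div_def] using hcross.div hdot one_ne_zero
  have hrate : Tendsto (fun t => |a t * d t - b t * c t| / (a t * c t + b t * d t) / t)
      (𝓝[>] 0) (𝓝 |v₂ - w₂|) := by
    have h := (((ha.mul (hd.tendsto_div_nhdsGT_zero hd0)).sub
      ((hb.tendsto_div_nhdsGT_zero hb0).mul hc)).abs).div hdot one_ne_zero
    rw [one_mul, mul_one, div_one, abs_sub_comm] at h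
    refine h.congr' ?_
    filter_upwards [self_mem_nhdsWithin] with t ht
    have hdiv : a t * (d t / t) - b t / t * c t = (a t * d t - b t * c t) / t := by ring
    simp only [Pi.div_apply]
    rw [hdiv, abs_div, abs_of_pos (Set.mem_Ioi.mp ht), div_right_comm]
  refine (tendsto_arctan_div hquot hrate).congr' ?_
  filter_upwards [hdot.eventually_const_lt one_pos] with t ht
  rw [euclAngle_eq_arctan ht]
end

section
/- Let p₁, p₂, p₃ ∈ ℝ² be three points whose first coordinates are pairwise distinct (a non-degenerate triangle in the degenerate plane ℝ^{1,0,1}). Then the sum of the interior degenerate-plane angles of the triangle is zero: θ(p₂ − p₁, p₃ − p₁) + θ(p₁ − p₂, p₃ − p₂) + θ(p₁ − p₃, p₂ − p₃) = 0. -/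
/-- The degenerate-plane angle between vectors with nonzero first coordinates. -/
noncomputable def degAngle (v w : ℝ × ℝ) : ℝ :=
  if 0 < v.1 * w.1 then |v.2 / v.1 - w.2 / w.1| else -|v.2 / v.1 - w.2 / w.1|

theorem degAngle_comm (v w : ℝ × ℝ) : degAngle v w = degAngle w v := by
  simp only [degAngle, mul_comm v.1 w.1, abs_sub_comm (v.2 / v.1) (w.2 / w.1)]

/-- The angle sum of a triangle whose vertices are ordered by first coordinate. -/
theorem degAngle_sum_eq_zero_of_lt {a b c : ℝ × ℝ} (hab : a.1 < b.1) (hbc : b.1 < c.1) :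
    degAngle (b - a) (c - a) + degAngle (a - b) (c - b) + degAngle (a - c) (b - c) = 0 := by
  have hu : 0 < b.1 - a.1 := sub_pos.2 hab
  have hv : 0 < c.1 - b.1 := sub_pos.2 hbc
  have hw : 0 < c.1 - a.1 := by linarith
  have swap (p q : ℝ × ℝ) : (p.2 - q.2) / (p.1 - q.1) = (q.2 - p.2) / (q.1 - p.1) := by
    rw [← neg_sub q.2, ← neg_sub q.1, neg_div_neg_eq]
  have hA : 0 < (b.1 - a.1) * (c.1 - a.1) := mul_pos hu hw
  have hB : ¬ 0 < (a.1 - b.1) * (c.1 - b.1) := by nlinarith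
  have hC : 0 < (a.1 - c.1) * (b.1 - c.1) := by nlinarith
  simp only [degAngle, Prod.fst_sub, Prod.snd_sub, if_pos hA, if_neg hB, if_pos hC,
    swap a b, swap a c, swap b c]
  set s := (b.2 - a.2) / (b.1 - a.1) with hs
  set t := (c.2 - b.2) / (c.1 - b.1) with ht
  have hr : (c.2 - a.2) / (c.1 - a.1) =
      (s * (b.1 - a.1) + t * (c.1 - b.1)) / (c.1 - a.1) := by
    rw [hs, ht, div_mul_cancel₀ _ hu.ne', div_mul_cancel₀ _ hv.ne']
    ring
  have h₁ : s - (c.2 - a.2) / (c.1 - a.1) = (s - t) * ((c.1 - b.1) / (c.1 - a.1)) := by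
    rw [hr]
    field_simp
    ring
  have h₂ : (c.2 - a.2) / (c.1 - a.1) - t = (s - t) * ((b.1 - a.1) / (c.1 - a.1)) := by
    rw [hr]
    field_simp
    ring
  rw [h₁, h₂, abs_mul, abs_mul, abs_of_pos (div_pos hv hw), abs_of_pos (div_pos hu hw)]
  field_simp
  ring

/-- The interior degenerate-plane angles of a non-degenerate triangle
sum to zero. -/
theorem stmt12 (p₁ p₂ p₃ : ℝ × ℝ)
    (h12 : p₁.1 ≠ p₂.1) (h13 : p₁.1 ≠ p₃.1) (h23 : p₂.1 ≠ p₃.1) :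
    degAngle (p₂ - p₁) (p₃ - p₁) + degAngle (p₁ - p₂) (p₃ - p₂)
      + degAngle (p₁ - p₃) (p₂ - p₃) = 0 := by
  have key := @degAngle_sum_eq_zero_of_lt
  have c₁ := degAngle_comm (p₂ - p₁) (p₃ - p₁)
  have c₂ := degAngle_comm (p₁ - p₂) (p₃ - p₂)
  have c₃ := degAngle_comm (p₁ - p₃) (p₂ - p₃)
  rcases lt_or_gt_of_ne h12 with h | h <;> rcases lt_or_gt_of_ne h13 with h' | h' <;>
    rcases lt_or_gt_of_ne h23 with h'' | h''
  · linarith [key h h'']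
  · linarith [key h' h'']
  · linarith
  · linarith [key h' h]
  · linarith [key h h']
  · linarith
  · linarith [key h'' h']
  · linarith [key h'' h]
end

section
/- Let p₁, p₂ ∈ ℝ² have distinct first coordinates x₁ ≠ x₂, and let p₃, p₄ ∈ ℝ² be points whose first coordinates x₃, x₄ satisfy (x₃ − x₁)(x₄ − x₁) > 0 and (x₃ − x₂)(x₄ − x₂) > 0 (so p₃ and p₄ lie in the same connected component of the set of points in spacelike position with respect to both p₁ and p₂). If p₄ lies in the topological interior of the triangle with vertices p₁, p₂, p₃ (the convex hull of {p₁, p₂, p₃}), then the degenerate-plane angles satisfy ∠(p₁, p₃, p₂) < ∠(p₁, p₄, p₂). -/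
/-- The degenerate-plane angle is the absolute cross product over the product of the first
coordinates, whatever the sign of the latter. -/
theorem degAngle_eq_div {v w : ℝ × ℝ} (h : v.1 * w.1 ≠ 0) :
    degAngle v w = |v.2 * w.1 - v.1 * w.2| / (v.1 * w.1) := by
  have hv : v.1 ≠ 0 := left_ne_zero_of_mul h
  have hw : w.1 ≠ 0 := right_ne_zero_of_mul h
  unfold degAngle
  rw [div_sub_div _ _ hv hw, abs_div]
  split_ifs with hpos
  · rw [abs_of_pos hpos]
  · rw [abs_of_neg (lt_of_le_of_ne (not_lt.mp hpos) h), div_neg, neg_neg]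

theorem exists_weights_of_mem_convexHull_triple {p q r x : ℝ × ℝ}
    (hx : x ∈ convexHull ℝ ({p, q, r} : Set (ℝ × ℝ))) :
    ∃ a b c : ℝ, 0 ≤ a ∧ 0 ≤ b ∧ 0 ≤ c ∧ a + b + c = 1 ∧ a • p + b • q + c • r = x := by
  rw [convexHull_insert (Set.insert_nonempty _ _), convexHull_pair] at hx
  obtain ⟨_, rfl, y, ⟨s, t, hs, ht, hst, rfl⟩, a, d, ha, hd, had, rfl⟩ := by
    simpa only [mem_convexJoin] using hx
  refine ⟨a, d * s, d * t, ha, mul_nonneg hd hs, mul_nonneg hd ht, ?_, ?_⟩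
  · rw [add_assoc, ← mul_add, hst, mul_one, had]
  · rw [smul_add, smul_smul, smul_smul, add_assoc]

theorem exists_pos_add_smul_mem_of_mem_interior {s : Set (ℝ × ℝ)} {x : ℝ × ℝ}
    (hx : x ∈ interior s) (w : ℝ × ℝ) : ∃ t : ℝ, 0 < t ∧ x + t • w ∈ s := by
  have hcont : Filter.Tendsto (fun t : ℝ => x + t • w) (nhds 0) (nhds x) := by
    have : Continuous fun t : ℝ => x + t • w := by fun_prop
    simpa using this.tendsto 0
  have hev := (hcont.eventually (mem_interior_iff_mem_nhds.mp hx)).filter_mono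
    (nhdsWithin_le_nhds (s := Set.Ioi 0))
  obtain ⟨t, hmem, ht⟩ := (hev.and self_mem_nhdsWithin).exists
  exact ⟨t, ht, hmem⟩

theorem exists_pos_weights_of_mem_interior_convexHull_triple {p q r x : ℝ × ℝ}
    (hx : x ∈ interior (convexHull ℝ ({p, q, r} : Set (ℝ × ℝ)))) :
    ∃ a b c : ℝ, 0 < a ∧ 0 < b ∧ 0 < c ∧ a + b + c = 1 ∧ a • p + b • q + c • r = x := by
  obtain ⟨t, ht, hmem⟩ := exists_pos_add_smul_mem_of_mem_interior hx
    (x - (1 / 3 : ℝ) • (p + q + r))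
  obtain ⟨a, b, c, ha, hb, hc, hsum, heq⟩ := exists_weights_of_mem_convexHull_triple hmem
  refine ⟨(a + t / 3) / (1 + t), (b + t / 3) / (1 + t), (c + t / 3) / (1 + t),
    by positivity, by positivity, by positivity, ?_, ?_⟩
  · field_simp
    linarith
  · have h1 := congrArg Prod.fst heq
    have h2 := congrArg Prod.snd heq
    simp only [Prod.fst_add, Prod.snd_add, Prod.fst_sub, Prod.snd_sub, Prod.smul_fst,
      Prod.smul_snd, smul_eq_mul] at h1 h2
    ext <;> simp only [Prod.fst_add, Prod.snd_add, Prod.smul_fst, Prod.smul_snd, smul_eq_mul] <;>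
      field_simp <;> linarith

/-- A triangle with nonempty interior and a non-vertical side `pq` is nondegenerate. -/
theorem cross_ne_zero_of_mem_interior_convexHull_triple {p q r x : ℝ × ℝ} (hpq : p.1 ≠ q.1)
    (hx : x ∈ interior (convexHull ℝ ({p, q, r} : Set (ℝ × ℝ)))) :
    (p - r).2 * (q - r).1 - (p - r).1 * (q - r).2 ≠ 0 := by
  intro h
  have collinear : ∀ y ∈ convexHull ℝ ({p, q, r} : Set (ℝ × ℝ)),
      (y.2 - p.2) * (q.1 - p.1) = (y.1 - p.1) * (q.2 - p.2) := by
    intro y hy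
    obtain ⟨a, b, c, -, -, -, hsum, rfl⟩ := exists_weights_of_mem_convexHull_triple hy
    obtain rfl : a = 1 - b - c := by linarith
    simp only [Prod.fst_add, Prod.snd_add, Prod.fst_sub, Prod.snd_sub, Prod.smul_fst,
      Prod.smul_snd, smul_eq_mul] at h ⊢
    linear_combination (-c) * h
  obtain ⟨t, ht, hmem⟩ := exists_pos_add_smul_mem_of_mem_interior hx (0, 1)
  have h1 := collinear _ hmem
  have h2 := collinear _ (interior_subset hx)
  simp only [Prod.fst_add, Prod.snd_add, Prod.smul_fst, Prod.smul_snd, smul_eq_mul] at h1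
  have h3 : t * (q.1 - p.1) = 0 := by linear_combination h1 - h2
  exact mul_ne_zero ht.ne' (sub_ne_zero.mpr hpq.symm) h3

/-- If p₄ lies inside the triangle p₁p₂p₃ and p₃, p₄ lie in the same
component of points spacelike with respect to both p₁ and p₂, then the degenerate
angle at p₄ subtending p₁p₂ exceeds that at p₃. -/
theorem stmt13 (p₁ p₂ p₃ p₄ : ℝ × ℝ) (h12 : p₁.1 ≠ p₂.1)
    (h341 : 0 < (p₃.1 - p₁.1) * (p₄.1 - p₁.1))
    (h342 : 0 < (p₃.1 - p₂.1) * (p₄.1 - p₂.1))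
    (h4 : p₄ ∈ interior (convexHull ℝ ({p₁, p₂, p₃} : Set (ℝ × ℝ)))) :
    degAngle (p₁ - p₃) (p₂ - p₃) < degAngle (p₁ - p₄) (p₂ - p₄) := by
  have hD := cross_ne_zero_of_mem_interior_convexHull_triple h12 h4
  obtain ⟨a, b, c, ha, hb, hc, hsum, rfl⟩ :=
    exists_pos_weights_of_mem_interior_convexHull_triple h4
  obtain rfl : a = 1 - b - c := by linarith
  set p₄ := (1 - b - c) • p₁ + b • p₂ + c • p₃ with hp₄
  have hx : p₄.1 = (1 - b - c) * p₁.1 + b * p₂.1 + c * p₃.1 := by simp [hp₄]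
  have hy : p₄.2 = (1 - b - c) * p₁.2 + b * p₂.2 + c * p₃.2 := by simp [hp₄]
  have hprod : 0 < ((p₁ - p₃).1 * (p₂ - p₃).1) * ((p₁ - p₄).1 * (p₂ - p₄).1) := by
    simp only [Prod.fst_sub]
    linear_combination mul_pos h341 h342
  have hne := left_ne_zero_of_mul hprod.ne'
  have hne' := right_ne_zero_of_mul hprod.ne'
  have hcross : (p₁ - p₄).2 * (p₂ - p₄).1 - (p₁ - p₄).1 * (p₂ - p₄).2 =
      c * ((p₁ - p₃).2 * (p₂ - p₃).1 - (p₁ - p₃).1 * (p₂ - p₃).2) := by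
    simp only [Prod.fst_sub, Prod.snd_sub, hx, hy]
    ring
  have hlt : (p₁ - p₄).1 * (p₂ - p₄).1 < c * ((p₁ - p₃).1 * (p₂ - p₃).1) := by
    have hab := mul_pos (mul_pos ha hb) (sq_pos_of_ne_zero (sub_ne_zero.mpr h12))
    have hbc := mul_nonneg (mul_pos hb hc).le (sq_nonneg (p₂.1 - p₃.1))
    have hac := mul_nonneg (mul_pos ha hc).le (sq_nonneg (p₁.1 - p₃.1))
    simp only [Prod.fst_sub, hx]
    linear_combination hab + hbc + hac
  rw [degAngle_eq_div hne, degAngle_eq_div hne', hcross, abs_mul, abs_of_pos hc, ← sub_pos,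
    div_sub_div _ _ hne' hne]
  refine div_pos ?_ (by linarith [hprod])
  linear_combination mul_pos (abs_pos.mpr hD) (sub_pos.mpr hlt)
end

section
/- Let α, D ∈ ℝ and β ≠ 0, and let S be the 𝒬-circle (a parabola) S = {(x, y) ∈ ℝ² : x² = α·x + β·y + D}. Let p₁ = (x₁, y₁), p₂ = (x₂, y₂), p₃ = (x₃, y₃) be three points of S with pairwise distinct first coordinates. Then the degenerate-plane angle at p₃ subtending p₁ and p₂ depends only on x₁, x₂ and the component of p₃: ∠(p₁, p₃, p₂) = |x₁ − x₂|/|β| if (x₁ − x₃)(x₂ − x₃) > 0, and ∠(p₁, p₃, p₂) = −|x₁ − x₂|/|β| if (x₁ − x₃)(x₂ − x₃) < 0. In particular the inscribed angle is locally constant as p₃ varies along S. -/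
/-- The slope of a chord of the parabola x² = αx + βy + D. -/
theorem parabola_chord_slope {α β D : ℝ} (hβ : β ≠ 0) {p q : ℝ × ℝ}
    (hp : p.1 ^ 2 = α * p.1 + β * p.2 + D) (hq : q.1 ^ 2 = α * q.1 + β * q.2 + D)
    (hpq : p.1 ≠ q.1) :
    (p - q).2 / (p - q).1 = (p.1 + q.1 - α) / β := by
  rw [Prod.fst_sub, Prod.snd_sub, div_eq_div_iff (sub_ne_zero.mpr hpq) hβ]
  linear_combination hq - hp

/-- The inscribed degenerate-plane angle subtending a chord of the
parabola x² = αx + βy + D depends only on x₁, x₂ and the component of p₃. -/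
theorem stmt14 (α β D : ℝ) (hβ : β ≠ 0) (p₁ p₂ p₃ : ℝ × ℝ)
    (h1 : p₁.1 ^ 2 = α * p₁.1 + β * p₁.2 + D)
    (h2 : p₂.1 ^ 2 = α * p₂.1 + β * p₂.2 + D)
    (h3 : p₃.1 ^ 2 = α * p₃.1 + β * p₃.2 + D)
    (h12 : p₁.1 ≠ p₂.1) (h13 : p₁.1 ≠ p₃.1) (h23 : p₂.1 ≠ p₃.1) :
    (0 < (p₁.1 - p₃.1) * (p₂.1 - p₃.1) →
      degAngle (p₁ - p₃) (p₂ - p₃) = |p₁.1 - p₂.1| / |β|) ∧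
    ((p₁.1 - p₃.1) * (p₂.1 - p₃.1) < 0 →
      degAngle (p₁ - p₃) (p₂ - p₃) = -(|p₁.1 - p₂.1| / |β|)) := by
  have key : |(p₁ - p₃).2 / (p₁ - p₃).1 - (p₂ - p₃).2 / (p₂ - p₃).1| =
      |p₁.1 - p₂.1| / |β| := by
    rw [parabola_chord_slope hβ h1 h3 h13, parabola_chord_slope hβ h2 h3 h23, ← abs_div]
    congr 1
    ring
  refine ⟨fun h => ?_, fun h => ?_⟩
  · rw [degAngle, if_pos (by simpa using h), key]
  · rw [degAngle, if_neg (by simpa using h.le), key]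
end

section
/- (Thales' theorem in the degenerate plane ℝ^{1,0,1}.) Let α, D ∈ ℝ and β ≠ 0, and let S = {(x, y) ∈ ℝ² : x² = α·x + β·y + D}. Let p₁ = (x₁, y₁), p₂ = (x₂, y₂), p₃ = (x₃, y₃) be points of S with pairwise distinct first coordinates, and let p₄ = (x₄, y₄) and p₅ = (x₅, y₅) be points with first coordinates distinct from x₁ and x₂, satisfying the same-component conditions (x₃ − x₁)(x₄ − x₁) > 0, (x₃ − x₂)(x₄ − x₂) > 0, (x₃ − x₁)(x₅ − x₁) > 0, (x₃ − x₂)(x₅ − x₂) > 0, and lying strictly on the same side of the line through p₁ and p₂ as p₃, i.e. det(p₂ − p₁, p₄ − p₁)·det(p₂ − p₁, p₃ − p₁) > 0 and det(p₂ − p₁, p₅ − p₁)·det(p₂ − p₁, p₃ − p₁) > 0, where det((u₁,u₂),(v₁,v₂)) = u₁v₂ − u₂v₁. Assume p₄ lies strictly inside S, i.e. x₄² < α·x₄ + β·y₄ + D, and p₅ lies strictly outside S, i.e. x₅² > α·x₅ + β·y₅ + D. Then the degenerate-plane angles satisfy ∠(p₁, p₄, p₂) > ∠(p₁, p₃, p₂)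 > ∠(p₁, p₅, p₂). -/
/-- The determinant of two vectors of ℝ². -/
def det2 (u v : ℝ × ℝ) : ℝ := u.1 * v.2 - u.2 * v.1

/-- The determinant of the chord `p₁p₂` of the parabola with the vector from `p₁` to `p`. -/
theorem det2_chord_mul (α β D : ℝ) (p₁ p₂ p : ℝ × ℝ)
    (h1 : p₁.1 ^ 2 = α * p₁.1 + β * p₁.2 + D)
    (h2 : p₂.1 ^ 2 = α * p₂.1 + β * p₂.2 + D) :
    β * det2 (p₂ - p₁) (p - p₁) = (p₂.1 - p₁.1) *
      ((p₁.1 - p.1) * (p₂.1 - p.1) + (α * p.1 + β * p.2 + D - p.1 ^ 2)) := by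
  simp only [det2, Prod.fst_sub, Prod.snd_sub]
  linear_combination (p₂.1 - p.1) * h1 - (p₁.1 - p.1) * h2

/-- The angle under which a chord of the parabola is seen from a point `p`. -/
theorem degAngle_chord (α β D : ℝ) (hβ : β ≠ 0) (p₁ p₂ p : ℝ × ℝ)
    (h1 : p₁.1 ^ 2 = α * p₁.1 + β * p₁.2 + D)
    (h2 : p₂.1 ^ 2 = α * p₂.1 + β * p₂.2 + D)
    (hp1 : p₁.1 ≠ p.1) (hp2 : p₂.1 ≠ p.1) :
    degAngle (p₁ - p) (p₂ - p) = |(p₁.1 - p₂.1) / β| *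
      (|(p₁.1 - p.1) * (p₂.1 - p.1) + (α * p.1 + β * p.2 + D - p.1 ^ 2)| /
        ((p₁.1 - p.1) * (p₂.1 - p.1))) := by
  have hu : p₁.1 - p.1 ≠ 0 := sub_ne_zero.2 hp1
  have hv : p₂.1 - p.1 ≠ 0 := sub_ne_zero.2 hp2
  have key : (p₁.2 - p.2) / (p₁.1 - p.1) - (p₂.2 - p.2) / (p₂.1 - p.1) =
      (p₁.1 - p₂.1) / β *
        (((p₁.1 - p.1) * (p₂.1 - p.1) + (α * p.1 + β * p.2 + D - p.1 ^ 2)) /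
          ((p₁.1 - p.1) * (p₂.1 - p.1))) := by
    field_simp
    linear_combination (p₁.1 - p.1) * h2 - (p₂.1 - p.1) * h1
  simp only [degAngle, Prod.fst_sub, Prod.snd_sub]
  rw [key, abs_mul, abs_div (_ + _)]
  split_ifs with h
  · rw [abs_of_pos h]
  · rw [abs_of_nonpos (not_lt.1 h), div_neg, mul_neg, neg_neg]

/-- If `P` and `P + s` have the same sign as `Q`, then `|P + s| / P - |Q| / Q` is a positive
multiple of `s`. -/
theorem abs_add_div_sub_abs_div {P Q s : ℝ} (hPQ : 0 < P * Q) (hs : 0 < (P + s) * Q) :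
    |P + s| / P - |Q| / Q = s / |P| := by
  rcases lt_trichotomy Q 0 with hQ | rfl | hQ
  · have hP : P < 0 := neg_of_mul_pos_left hPQ hQ.le
    have hPs : P + s < 0 := neg_of_mul_pos_left hs hQ.le
    rw [abs_of_neg hQ, abs_of_neg hP, abs_of_neg hPs]
    field_simp [hP.ne, hQ.ne]
    ring
  · simp at hPQ
  · have hP : 0 < P := pos_of_mul_pos_left hPQ hQ.le
    have hPs : 0 < P + s := pos_of_mul_pos_left hs hQ.le
    rw [abs_of_pos hQ, abs_of_pos hP, abs_of_pos hPs]
    field_simp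
    ring

/-- Comparison of the angles seen from a point `q` of the parabola and from a point `p` in the
same component and on the same side of the chord. -/
theorem degAngle_chord_sub (α β D : ℝ) (hβ : β ≠ 0) (p₁ p₂ q p : ℝ × ℝ)
    (h1 : p₁.1 ^ 2 = α * p₁.1 + β * p₁.2 + D)
    (h2 : p₂.1 ^ 2 = α * p₂.1 + β * p₂.2 + D)
    (hq : q.1 ^ 2 = α * q.1 + β * q.2 + D)
    (hq1 : p₁.1 ≠ q.1) (hq2 : p₂.1 ≠ q.1) (hp1 : p₁.1 ≠ p.1) (hp2 : p₂.1 ≠ p.1)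
    (hc1 : 0 < (q.1 - p₁.1) * (p.1 - p₁.1)) (hc2 : 0 < (q.1 - p₂.1) * (p.1 - p₂.1))
    (hside : 0 < det2 (p₂ - p₁) (p - p₁) * det2 (p₂ - p₁) (q - p₁)) :
    degAngle (p₁ - p) (p₂ - p) - degAngle (p₁ - q) (p₂ - q) = |(p₁.1 - p₂.1) / β| *
      ((α * p.1 + β * p.2 + D - p.1 ^ 2) / |(p₁.1 - p.1) * (p₂.1 - p.1)|) := by
  have hq0 : α * q.1 + β * q.2 + D - q.1 ^ 2 = 0 := by linarith
  have dp := det2_chord_mul α β D p₁ p₂ p h1 h2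
  have dq := det2_chord_mul α β D p₁ p₂ q h1 h2
  rw [degAngle_chord α β D hβ p₁ p₂ p h1 h2 hp1 hp2,
    degAngle_chord α β D hβ p₁ p₂ q h1 h2 hq1 hq2]
  rw [hq0, add_zero] at dq ⊢
  rw [← mul_sub, abs_add_div_sub_abs_div]
  · linear_combination mul_pos hc1 hc2
  · have h := mul_pos (sq_pos_of_ne_zero hβ) hside
    rw [show β ^ 2 * (det2 (p₂ - p₁) (p - p₁) * det2 (p₂ - p₁) (q - p₁)) =
      (β * det2 (p₂ - p₁) (p - p₁)) * (β * det2 (p₂ - p₁) (q - p₁)) by ring, dp, dq,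
      mul_mul_mul_comm] at h
    exact pos_of_mul_pos_right h (mul_self_nonneg _)

/-- Thales' theorem in the degenerate plane ℝ^{1,0,1}. -/
theorem stmt15 (α β D : ℝ) (hβ : β ≠ 0) (p₁ p₂ p₃ p₄ p₅ : ℝ × ℝ)
    (h1 : p₁.1 ^ 2 = α * p₁.1 + β * p₁.2 + D)
    (h2 : p₂.1 ^ 2 = α * p₂.1 + β * p₂.2 + D)
    (h3 : p₃.1 ^ 2 = α * p₃.1 + β * p₃.2 + D)
    (h12 : p₁.1 ≠ p₂.1) (h13 : p₁.1 ≠ p₃.1) (h23 : p₂.1 ≠ p₃.1)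
    (h41 : p₄.1 ≠ p₁.1) (h42 : p₄.1 ≠ p₂.1)
    (h51 : p₅.1 ≠ p₁.1) (h52 : p₅.1 ≠ p₂.1)
    (hc41 : 0 < (p₃.1 - p₁.1) * (p₄.1 - p₁.1))
    (hc42 : 0 < (p₃.1 - p₂.1) * (p₄.1 - p₂.1))
    (hc51 : 0 < (p₃.1 - p₁.1) * (p₅.1 - p₁.1))
    (hc52 : 0 < (p₃.1 - p₂.1) * (p₅.1 - p₂.1))
    (hside4 : 0 < det2 (p₂ - p₁) (p₄ - p₁) * det2 (p₂ - p₁) (p₃ - p₁))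
    (hside5 : 0 < det2 (p₂ - p₁) (p₅ - p₁) * det2 (p₂ - p₁) (p₃ - p₁))
    (hin : p₄.1 ^ 2 < α * p₄.1 + β * p₄.2 + D)
    (hout : p₅.1 ^ 2 > α * p₅.1 + β * p₅.2 + D) :
    degAngle (p₁ - p₄) (p₂ - p₄) > degAngle (p₁ - p₃) (p₂ - p₃) ∧
      degAngle (p₁ - p₃) (p₂ - p₃) > degAngle (p₁ - p₅) (p₂ - p₅) := by
  have hK : 0 < |(p₁.1 - p₂.1) / β| := abs_pos.2 (div_ne_zero (sub_ne_zero.2 h12) hβ)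
  have hP {p : ℝ × ℝ} (hp1 : p.1 ≠ p₁.1) (hp2 : p.1 ≠ p₂.1) :
      0 < |(p₁.1 - p.1) * (p₂.1 - p.1)| :=
    abs_pos.2 (mul_ne_zero (sub_ne_zero.2 hp1.symm) (sub_ne_zero.2 hp2.symm))
  constructor
  · rw [gt_iff_lt, ← sub_pos, degAngle_chord_sub α β D hβ p₁ p₂ p₃ p₄ h1 h2 h3 h13 h23
      h41.symm h42.symm hc41 hc42 hside4]
    exact mul_pos hK (div_pos (sub_pos.2 hin) (hP h41 h42))
  · rw [gt_iff_lt, ← sub_neg, degAngle_chord_sub α β D hβ p₁ p₂ p₃ p₅ h1 h2 h3 h13 h23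
      h51.symm h52.symm hc51 hc52 hside5]
    exact mul_neg_of_pos_of_neg hK (div_neg_of_neg_of_pos (sub_neg.2 hout) (hP h51 h52))
end

section
/- Let x, y, z ∈ ℝ^d and let c = (x + y)/2 be the midpoint of x and y. If Q(z − c) < Q(x − c) (note Q(x − c) = Q(y − c) = Q(x − y)/4, so z lies strictly inside the Q-ball with diameter [x, y]), then Q(z − x) + Q(z − y) < Q(x − y). In particular, if moreover Q(z − x) ≥ 0 and Q(z − y) ≥ 0, then Q(z − x) < Q(x − y) and Q(z − y) < Q(x − y). (This is the key inequality showing that every Q-minimum spanning tree is a subgraph of the Q-Delaunay triangulation.) -/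
/-- If z lies strictly inside the Q-ball with diameter [x, y], then
Q(z−x) + Q(z−y) < Q(x−y); the key inequality for Q-minimum spanning trees. -/
theorem stmt16 (d : ℕ)
    (B : (Fin d → ℝ) →ₗ[ℝ] (Fin d → ℝ) →ₗ[ℝ] ℝ)
    (hBsymm : ∀ x y, B x y = B y x)
    (x y z : Fin d → ℝ)
    (h : B (z - (1 / 2 : ℝ) • (x + y)) (z - (1 / 2 : ℝ) • (x + y))
        < B (x - (1 / 2 : ℝ) • (x + y)) (x - (1 / 2 : ℝ) • (x + y))) :
    B (z - x) (z - x) + B (z - y) (z - y) < B (x - y) (x - y) ∧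
      (0 ≤ B (z - x) (z - x) → 0 ≤ B (z - y) (z - y) →
        B (z - x) (z - x) < B (x - y) (x - y) ∧
          B (z - y) (z - y) < B (x - y) (x - y)) := by
  have key : B (z - x) (z - x) + B (z - y) (z - y) < B (x - y) (x - y) := by
    simp only [map_sub, map_add, map_smul, LinearMap.sub_apply, LinearMap.add_apply,
      LinearMap.smul_apply, smul_eq_mul] at h ⊢
    linarith
  exact ⟨key, fun hx hy => ⟨by linarith, by linarith⟩⟩
end
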